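/- arXiv:2004.05299 — 4 statements merged into one kernel-verified Lean document; each statement's English description precedes it below -/
import Mathlib

section
/- Let λ > 0, let μ be a probability measure on ℝ^d with finite second moment, and let φ : ℝ^d → ℝ be a convex, λ-smooth, differentiable function whose gradient pushes μ forward to a probability measure ν (i.e. (∇φ)_# μ = ν). Then the Legendre transform φ* satisfies −φ(0) ≤ ∫_{ℝ^d} φ*(y) dν(y) ≤ −φ(0) + (λ/2) ∫_{ℝ^d} |x|² dμ(x); in particular −∞ < ∫ φ* dν < +∞. -/
open MeasureTheory RealInnerProductSpace

noncomputable section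

/-- The Legendre transform of `φ`, with values in the extended reals. -/
noncomputable def legendre {d : ℕ} (φ : EuclideanSpace ℝ (Fin d) → ℝ)
    (y : EuclideanSpace ℝ (Fin d)) : EReal :=
  ⨆ z : EuclideanSpace ℝ (Fin d), ((⟪y, z⟫ - φ z : ℝ) : EReal)

theorem convex_first_order {E : Type*} [NormedAddCommGroup E] [NormedSpace ℝ E] {f : E → ℝ}
    (hf : ConvexOn ℝ Set.univ f) {f' : E →L[ℝ] ℝ} {x : E} (h : HasFDerivAt f f' x) (y : E) :
    f x + f' (y - x) ≤ f y := by
  have hg : ConvexOn ℝ Set.univ (fun t : ℝ => f (AffineMap.lineMap x y t)) := by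
    exact hf.comp_affineMap (AffineMap.lineMap (k := ℝ) x y)
  have hd : HasDerivAt (fun t : ℝ => f (AffineMap.lineMap x y t)) (f' (y - x)) 0 := by
    have h1 : HasDerivAt (fun t : ℝ => AffineMap.lineMap (k := ℝ) x y t) (y - x) 0 :=
      AffineMap.hasDerivAt_lineMap
    have h2 : HasFDerivAt f f' (AffineMap.lineMap (k := ℝ) x y (0 : ℝ)) := by simpa using h
    exact h2.comp_hasDerivAt (0 : ℝ) h1
  have := hg.le_slope_of_hasDerivAt (Set.mem_univ 0) (Set.mem_univ 1) one_pos hd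
  simp [slope_def_field] at this
  simp
  linarith

theorem legendre_measurable {d : ℕ} (φ : EuclideanSpace ℝ (Fin d) → ℝ) :
    Measurable (legendre φ) := by
  apply LowerSemicontinuous.measurable
  unfold legendre
  apply lowerSemicontinuous_iSup
  intro z
  apply Continuous.lowerSemicontinuous
  exact continuous_coe_real_ereal.comp (by fun_prop)

/-- If `μ` is a probability measure with finite second moment and `φ` is convex, `λ`-smooth and
differentiable with `(∇φ)_# μ = ν`, then `φ*` is `ν`-a.e. finite, integrable with respect to `ν`,
and `−φ(0) ≤ ∫ φ* dν ≤ −φ(0) + (λ/2)∫|x|² dμ`; in particular `−∞ < ∫ φ* dν < +∞`. -/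
theorem integral_legendre_finite {d : ℕ} (lam : ℝ) (hlam : 0 < lam)
    (μ ν : Measure (EuclideanSpace ℝ (Fin d)))
    [IsProbabilityMeasure μ] [IsProbabilityMeasure ν]
    (hmom : Integrable (fun x => ‖x‖ ^ 2) μ)
    (φ : EuclideanSpace ℝ (Fin d) → ℝ)
    (hconv : ConvexOn ℝ Set.univ φ)
    (hsmooth : ConvexOn ℝ Set.univ (fun x => lam / 2 * ‖x‖ ^ 2 - φ x))
    (hdiff : Differentiable ℝ φ)
    (hpush : μ.map (fun x => gradient φ x) = ν) :
    (∀ᵐ y ∂ν, legendre φ y ≠ ⊤) ∧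
    Integrable (fun y => (legendre φ y).toReal) ν ∧
    -φ 0 ≤ ∫ y, (legendre φ y).toReal ∂ν ∧
    ∫ y, (legendre φ y).toReal ∂ν ≤ -φ 0 + lam / 2 * ∫ x, ‖x‖ ^ 2 ∂μ := by
  have hfirst : ∀ x z, φ x + ⟪gradient φ x, z - x⟫ ≤ φ z := by
    intro x z
    have := convex_first_order hconv (hdiff x).hasGradientAt.hasFDerivAt z
    simpa using this
  have hsecond : ∀ x, ⟪gradient φ x, x⟫ - φ x ≤ -φ 0 + lam / 2 * ‖x‖ ^ 2 := by
    intro x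
    have h1 : HasFDerivAt (fun x : EuclideanSpace ℝ (Fin d) => lam / 2 * ‖x‖ ^ 2 - φ x) _ x :=
      (((hasStrictFDerivAt_norm_sq x).hasFDerivAt).const_mul (lam / 2)).sub
        (hdiff x).hasGradientAt.hasFDerivAt
    have := convex_first_order hsmooth h1 0
    have h2 : ⟪gradient φ x, x⟫ = fderiv ℝ φ x x := by simp
    simp at this
    linarith
  have hleg : ∀ x, legendre φ (gradient φ x) = ((⟪gradient φ x, x⟫ - φ x : ℝ) : EReal) := by
    intro x
    apply le_antisymm
    · apply iSup_le
      intro z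
      have := hfirst x z
      rw [inner_sub_right] at this
      exact_mod_cast (by linarith)
    · exact le_iSup (fun z => ((⟪gradient φ x, z⟫ - φ z : ℝ) : EReal)) x
  have hlow : ∀ x, -φ 0 ≤ ⟪gradient φ x, x⟫ - φ x := by
    intro x
    have := hfirst x 0
    rw [zero_sub, inner_neg_right] at this
    linarith
  have hgm : Measurable (fun x => gradient φ x) := by
    unfold gradient
    exact (InnerProductSpace.toDual ℝ _).symm.continuous.measurable.comp (measurable_fderiv ℝ φ)
  have hLm : Measurable (fun y => (legendre φ y).toReal) := (legendre_measurable φ).ereal_toReal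
  have hub : Integrable (fun x => -φ 0 + lam / 2 * ‖x‖ ^ 2) μ :=
    (integrable_const _).add (hmom.const_mul _)
  have hcomp : ∀ x, (legendre φ (gradient φ x)).toReal = ⟪gradient φ x, x⟫ - φ x := by
    intro x
    rw [hleg, EReal.toReal_coe]
  have hint : Integrable (fun x => (legendre φ (gradient φ x)).toReal) μ := by
    refine integrable_of_le_of_le (hLm.comp hgm).aestronglyMeasurable
      (g₁ := fun _ => -φ 0) (ae_of_all _ fun x => ?_) (ae_of_all _ fun x => ?_)
      (integrable_const _) hub
    · simpa only [hcomp] using hlow x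
    · simpa only [hcomp] using hsecond x
  subst hpush
  rw [integral_map hgm.aemeasurable hLm.aestronglyMeasurable]
  refine ⟨?_, ?_, ?_, ?_⟩
  · refine (ae_map_iff hgm.aemeasurable
      ((legendre_measurable φ) (measurableSet_singleton ⊤)).compl).2 ?_
    refine ae_of_all _ fun x => ?_
    change legendre φ (gradient φ x) ≠ ⊤
    rw [hleg]
    exact EReal.coe_ne_top _
  · exact (integrable_map_measure hLm.aestronglyMeasurable hgm.aemeasurable).2 hint
  · have := integral_mono (integrable_const (-φ 0)) hint
      (fun x => by simpa only [hcomp] using hlow x)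
    simpa using this
  · have := integral_mono hint hub (fun x => by simpa only [hcomp] using hsecond x)
    rw [integral_add (integrable_const _) (hmom.const_mul _), integral_const_mul] at this
    simpa using this
end
end

section
/- Let λ > 0, let μ and ν be probability measures on ℝ^d with finite second moments, with ν absolutely continuous with density g, and let (μ, ν, φ) be λ-regular with optimal map T = ∇φ. Let μ_h = Σ_{i=1}^N f_i δ_{x_i} with f_i > 0 and Σ_i f_i = 1, let φ_h be a nodal function solving the semi-discrete problem ν(F_i) = f_i for all i, where F_i are the associated Laguerre cells, and assume the induced semi-discrete plan γ_h ∈ Π(μ_h, ν) is an optimal coupling of (μ_h, ν). Then Σ_{i=1}^N ∫_{F_i} |T(x_i) − y|² g(y) dy ≤ E_h², where E_h = 2 λ^{1/2} W₂(μ, μ_h)^{1/2} (W₂(μ,ν) + W₂(μ, μ_h))^{1/2} + λ W₂(μ, μ_h). -/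
open MeasureTheory RealInnerProductSpace

noncomputable section

/-- `γ` is a coupling of `μ` and `ν`: its marginals are `μ` and `ν`. -/
def IsCoupling {α : Type*} [MeasurableSpace α] (γ : Measure (α × α)) (μ ν : Measure α) : Prop :=
  γ.map Prod.fst = μ ∧ γ.map Prod.snd = ν

/-- The squared Wasserstein-type minimal transport cost for a cost function `c`, followed by a
square root. -/
noncomputable def W2Cost {α : Type*} [MeasurableSpace α] (c : α → α → ℝ) (μ ν : Measure α) : ℝ :=
  Real.sqrt (⨅ γ ∈ {γ : Measure (α × α) | IsCoupling γ μ ν},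
    ∫⁻ p, ENNReal.ofReal (c p.1 p.2) ∂γ).toReal

/-- The 2-Wasserstein distance. -/
noncomputable def W2 {α : Type*} [MeasurableSpace α] [NormedAddCommGroup α]
    (μ ν : Measure α) : ℝ :=
  W2Cost (fun a b => ‖a - b‖ ^ 2) μ ν

/-- `(μ, ν, φ)` is `λ`-regular: `φ` is convex, differentiable, `λ`-smooth, `∇φ` pushes `μ`
forward to `ν`, and `∇φ` is an optimal transport map for the quadratic cost. -/
def LambdaRegular {d : ℕ} (lam : ℝ) (μ ν : Measure (EuclideanSpace ℝ (Fin d)))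
    (φ : EuclideanSpace ℝ (Fin d) → ℝ) : Prop :=
  ConvexOn ℝ Set.univ φ ∧ Differentiable ℝ φ ∧
  ConvexOn ℝ Set.univ (fun x => lam / 2 * ‖x‖ ^ 2 - φ x) ∧
  μ.map (fun x => gradient φ x) = ν ∧
  ∫ x, ‖gradient φ x - x‖ ^ 2 ∂μ = (W2 μ ν) ^ 2

/-- First order characterization of convexity. -/
lemma convex_grad_ineq {E : Type*} [NormedAddCommGroup E] [InnerProductSpace ℝ E]
    {f : E → ℝ} (hc : ConvexOn ℝ Set.univ f) {x z : E} {L : E →L[ℝ] ℝ}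
    (hd : HasFDerivAt f L x) : f x + L (z - x) ≤ f z := by
  have h1 : ConvexOn ℝ Set.univ (fun t : ℝ => f (x + t • (z - x))) := by
    refine ⟨convex_univ, ?_⟩
    intro s _ t _ a b ha hb hab
    have h := hc.2 (Set.mem_univ (x + s • (z - x))) (Set.mem_univ (x + t • (z - x))) ha hb hab
    have e : a • (x + s • (z - x)) + b • (x + t • (z - x))
        = x + (a • s + b • t) • (z - x) := by
      obtain rfl : b = 1 - a := by linarith
      simp only [smul_eq_mul]
      module
    rw [e] at h
    exact h
  have h2 : HasDerivAt (fun t : ℝ => f (x + t • (z - x))) (L (z - x)) 0 := by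
    have hl : HasDerivAt (fun t : ℝ => x + t • (z - x)) (z - x) 0 := by
      simpa using ((hasDerivAt_id (0 : ℝ)).smul_const (z - x)).const_add x
    have hd' : HasFDerivAt f L (x + (0 : ℝ) • (z - x)) := by simpa using hd
    exact hd'.comp_hasDerivAt 0 hl
  have h3 := h1.le_slope_of_hasDerivAt (Set.mem_univ 0) (Set.mem_univ 1) one_pos h2
  simp [slope_def_field] at h3
  rw [map_sub]
  linarith

section core
variable {d : ℕ}

lemma integrable_inner_of_sq {Ω : Type*} [MeasurableSpace Ω] {m : Measure Ω}
    {a b : Ω → EuclideanSpace ℝ (Fin d)} (ha : Measurable a) (hb : Measurable b)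
    (ha2 : Integrable (fun p => ‖a p‖ ^ 2) m) (hb2 : Integrable (fun p => ‖b p‖ ^ 2) m) :
    Integrable (fun p => ⟪a p, b p⟫) m := by
  refine (ha2.add hb2).mono' (ha.inner hb).aestronglyMeasurable (ae_of_all _ fun p => ?_)
  have := abs_real_inner_le_norm (a p) (b p)
  simp only [Real.norm_eq_abs, Pi.add_apply]
  nlinarith [sq_nonneg (‖a p‖ - ‖b p‖), sq_nonneg ‖a p‖, sq_nonneg ‖b p‖]

lemma integrable_norm_sub_sq {Ω : Type*} [MeasurableSpace Ω] {m : Measure Ω}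
    {a b : Ω → EuclideanSpace ℝ (Fin d)} (ha : Measurable a) (hb : Measurable b)
    (ha2 : Integrable (fun p => ‖a p‖ ^ 2) m) (hb2 : Integrable (fun p => ‖b p‖ ^ 2) m) :
    Integrable (fun p => ‖a p - b p‖ ^ 2) m := by
  simp_rw [norm_sub_sq_real]
  exact (ha2.sub ((integrable_inner_of_sq ha hb ha2 hb2).const_mul 2)).add hb2

lemma integral_norm_sub_sq {Ω : Type*} [MeasurableSpace Ω] {m : Measure Ω}
    {a b : Ω → EuclideanSpace ℝ (Fin d)} (ha : Measurable a) (hb : Measurable b)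
    (ha2 : Integrable (fun p => ‖a p‖ ^ 2) m) (hb2 : Integrable (fun p => ‖b p‖ ^ 2) m) :
    ∫ p, ‖a p - b p‖ ^ 2 ∂m
      = ∫ p, ‖a p‖ ^ 2 ∂m - 2 * ∫ p, ⟪a p, b p⟫ ∂m + ∫ p, ‖b p‖ ^ 2 ∂m := by
  simp_rw [norm_sub_sq_real]
  have hi := (integrable_inner_of_sq ha hb ha2 hb2).const_mul 2
  have hs : Integrable (fun p => ‖a p‖ ^ 2 - 2 * ⟪a p, b p⟫) m := ha2.sub hi
  rw [integral_add hs hb2, integral_sub ha2 hi, integral_const_mul]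

/-- A quadratically controlled potential is integrable. -/
lemma integrable_potential {lam : ℝ} (hlam : 0 < lam)
    {φ : EuclideanSpace ℝ (Fin d) → ℝ} {T : EuclideanSpace ℝ (Fin d) → EuclideanSpace ℝ (Fin d)}
    (hφ : Continuous φ)
    (hsup : ∀ x z, φ x + ⟪T x, z - x⟫ ≤ φ z)
    (hsm : ∀ x z, φ z ≤ φ x + ⟪T x, z - x⟫ + lam / 2 * ‖z - x‖ ^ 2)
    (m : Measure (EuclideanSpace ℝ (Fin d))) [IsFiniteMeasure m]
    (hm : Integrable (fun x => ‖x‖ ^ 2) m) : Integrable φ m := by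
  refine ((integrable_const (|φ 0| + ‖T 0‖ ^ 2)).add (hm.const_mul (1 + lam / 2))).mono'
    hφ.aestronglyMeasurable (ae_of_all _ fun z => ?_)
  have h1 := hsup 0 z
  have h2 := hsm 0 z
  rw [sub_zero] at h1 h2
  have h3 := abs_le.1 (abs_real_inner_le_norm (T 0) z)
  have h4 : ‖T 0‖ * ‖z‖ ≤ ‖T 0‖ ^ 2 + ‖z‖ ^ 2 := by
    nlinarith [sq_nonneg (‖T 0‖ - ‖z‖), sq_nonneg ‖T 0‖, sq_nonneg ‖z‖]
  have h5 := neg_abs_le (φ 0)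
  have h6 := le_abs_self (φ 0)
  have h7 : 0 ≤ lam / 2 * ‖z‖ ^ 2 := by positivity
  simp only [Real.norm_eq_abs, Pi.add_apply]
  rw [abs_le]
  constructor <;> nlinarith

/-- The (countable) Legendre transform. -/
lemma exists_conjugate {lam : ℝ} (hlam : 0 < lam)
    {φ : EuclideanSpace ℝ (Fin d) → ℝ} {T : EuclideanSpace ℝ (Fin d) → EuclideanSpace ℝ (Fin d)}
    (hφ : Continuous φ)
    (hsup : ∀ x z, φ x + ⟪T x, z - x⟫ ≤ φ z)
    (hsm : ∀ x z, φ z ≤ φ x + ⟪T x, z - x⟫ + lam / 2 * ‖z - x‖ ^ 2) :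
    ∃ ψ : EuclideanSpace ℝ (Fin d) → ℝ, Measurable ψ ∧ (∀ x, ψ (T x) = ⟪x, T x⟫ - φ x) ∧
      ∃ P : Set (EuclideanSpace ℝ (Fin d)), MeasurableSet P ∧ (∀ x, T x ∈ P) ∧
        ∀ x, ∀ y ∈ P, ‖T x - y‖ ^ 2 ≤ 2 * lam * (φ x + ψ y - ⟪x, y⟫) := by
  let D := TopologicalSpace.denseSeq (EuclideanSpace ℝ (Fin d))
  have hD : DenseRange D := TopologicalSpace.denseRange_denseSeq _
  let ψ : EuclideanSpace ℝ (Fin d) → ℝ := fun y => ⨆ n, (⟪D n, y⟫ - φ (D n))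
  have hψ : Measurable ψ := by
    refine Measurable.iSup fun n => ?_
    have : Continuous fun y : EuclideanSpace ℝ (Fin d) => ⟪D n, y⟫ - φ (D n) := by fun_prop
    exact this.measurable
  have hub : ∀ x z, ⟪z, T x⟫ - φ z ≤ ⟪x, T x⟫ - φ x := by
    intro x z
    have := hsup x z
    rw [inner_sub_right, real_inner_comm, real_inner_comm x] at this
    linarith
  have hbdd : ∀ x, BddAbove (Set.range fun n => ⟪D n, T x⟫ - φ (D n)) := by
    intro x
    refine ⟨⟪x, T x⟫ - φ x, ?_⟩
    rintro _ ⟨n, rfl⟩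
    exact hub x (D n)
  let P : Set (EuclideanSpace ℝ (Fin d)) := {y | ∀ n, ⟪D n, y⟫ - φ (D n) ≤ ψ y}
  have hext : ∀ y ∈ P, ∀ z, ⟪z, y⟫ - φ z ≤ ψ y := by
    intro y hy z
    have hcl : IsClosed {z : EuclideanSpace ℝ (Fin d) | ⟪z, y⟫ - φ z ≤ ψ y} :=
      isClosed_le (by fun_prop) continuous_const
    exact hD.induction_on z hcl hy
  have hTP : ∀ x, T x ∈ P := fun x n => le_ciSup (hbdd x) n
  refine ⟨ψ, hψ, ?_, P, ?_, hTP, ?_⟩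
  · intro x
    exact le_antisymm (ciSup_le fun n => hub x (D n)) (hext _ (hTP x) x)
  · have : P = ⋂ n, {y | ⟪D n, y⟫ - φ (D n) ≤ ψ y} := by ext y; simp [P]
    rw [this]
    refine MeasurableSet.iInter fun n => measurableSet_le ?_ hψ
    have : Continuous fun y : EuclideanSpace ℝ (Fin d) => ⟪D n, y⟫ - φ (D n) := by fun_prop
    exact this.measurable
  · intro x y hy
    have h1 := hext y hy (x + lam⁻¹ • (y - T x))
    have h2 := hsm x (x + lam⁻¹ • (y - T x))
    rw [add_sub_cancel_left, norm_smul, inner_smul_right, mul_pow, Real.norm_eq_abs, sq_abs] at h2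
    rw [inner_add_left, real_inner_smul_left] at h1
    have h3 : ⟪y - T x, y⟫ - ⟪T x, y - T x⟫ = ‖y - T x‖ ^ 2 := by
      rw [real_inner_comm (y - T x) (T x), ← inner_sub_right, real_inner_self_eq_norm_sq]
    rw [norm_sub_rev]
    have h4 : lam⁻¹ * ‖y - T x‖ ^ 2 - lam / 2 * (lam⁻¹ ^ 2 * ‖y - T x‖ ^ 2)
        ≤ φ x + ψ y - ⟪x, y⟫ := by
      rw [← h3, mul_sub, h3]; linarith
    have h5 : lam⁻¹ * ‖y - T x‖ ^ 2 - lam / 2 * (lam⁻¹ ^ 2 * ‖y - T x‖ ^ 2)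
        = ‖y - T x‖ ^ 2 / (2 * lam) := by field_simp; ring
    rw [h5, div_le_iff₀ (by positivity)] at h4
    linarith

/-- The stability estimate tested with an arbitrary coupling `α` of `μ` and `μh`. -/
lemma core_estimate {lam : ℝ} (hlam : 0 < lam)
    {φ : EuclideanSpace ℝ (Fin d) → ℝ} {T : EuclideanSpace ℝ (Fin d) → EuclideanSpace ℝ (Fin d)}
    (hφ : Continuous φ) (hT : Measurable T)
    (hsup : ∀ x z, φ x + ⟪T x, z - x⟫ ≤ φ z)
    (hsm : ∀ x z, φ z ≤ φ x + ⟪T x, z - x⟫ + lam / 2 * ‖z - x‖ ^ 2)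
    (μ ν μh : Measure (EuclideanSpace ℝ (Fin d))) [IsFiniteMeasure μ] [IsFiniteMeasure μh]
    (hμ2 : Integrable (fun x => ‖x‖ ^ 2) μ) (hν2 : Integrable (fun x => ‖x‖ ^ 2) ν)
    (hμh2 : Integrable (fun x => ‖x‖ ^ 2) μh)
    (hpush : μ.map T = ν)
    (γ α : Measure (EuclideanSpace ℝ (Fin d) × EuclideanSpace ℝ (Fin d)))
    (hγ : IsCoupling γ μh ν) (hα : IsCoupling α μ μh)
    (hopt : ∫ p, ‖p.1 - p.2‖ ^ 2 ∂γ ≤ ∫ p, ‖p.2 - T p.1‖ ^ 2 ∂α) :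
    Integrable (fun p => ‖T p.1 - p.2‖ ^ 2) γ ∧
    ∫ p, ‖T p.1 - p.2‖ ^ 2 ∂γ ≤ lam ^ 2 * ∫ p, ‖p.1 - p.2‖ ^ 2 ∂α := by
  obtain ⟨ψ, hψ, hψT, P, hP, hTP, hbound⟩ := exists_conjugate hlam hφ hsup hsm
  obtain ⟨hγ1, hγ2⟩ := hγ
  obtain ⟨hα1, hα2⟩ := hα
  have hφμ : Integrable φ μ := integrable_potential hlam hφ hsup hsm μ hμ2
  have hφh : Integrable φ μh := integrable_potential hlam hφ hsup hsm μh hμh2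
  have hT2 : Integrable (fun x => ‖T x‖ ^ 2) μ := by
    rw [← hpush] at hν2
    exact hν2.comp_measurable hT
  -- transfer along marginals
  have tr {m : Measure (EuclideanSpace ℝ (Fin d))}
      {κ : Measure (EuclideanSpace ℝ (Fin d) × EuclideanSpace ℝ (Fin d))}
      {π : EuclideanSpace ℝ (Fin d) × EuclideanSpace ℝ (Fin d) → EuclideanSpace ℝ (Fin d)}
      (hπ : Measurable π) (hm : κ.map π = m) {h : EuclideanSpace ℝ (Fin d) → ℝ}
      (hh : Integrable h m) :
      Integrable (fun p => h (π p)) κ ∧ ∫ p, h (π p) ∂κ = ∫ z, h z ∂m := by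
    subst hm
    exact ⟨hh.comp_measurable hπ, (integral_map hπ.aemeasurable hh.1).symm⟩
  have hTx : Integrable (fun x => ⟪x, T x⟫) μ := integrable_inner_of_sq measurable_id hT hμ2 hT2
  have hψν : Integrable ψ ν := by
    rw [← hpush, integrable_map_measure hψ.aestronglyMeasurable hT.aemeasurable]
    refine (hTx.sub hφμ).congr (ae_of_all _ fun x => ?_)
    simp [hψT]
  have hψint : ∫ y, ψ y ∂ν = ∫ x, ⟪x, T x⟫ ∂μ - ∫ x, φ x ∂μ := by
    rw [← hpush, integral_map hT.aemeasurable hψ.aestronglyMeasurable, ← integral_sub hTx hφμ]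
    simp [hψT]
  have hT2int : ∫ y, ‖y‖ ^ 2 ∂ν = ∫ x, ‖T x‖ ^ 2 ∂μ := by
    rw [← hpush, integral_map hT.aemeasurable]
    exact (by fun_prop : Continuous fun y : EuclideanSpace ℝ (Fin d) => ‖y‖ ^ 2).aestronglyMeasurable
  -- `γ` side
  have g1 := tr measurable_fst hγ1 hμh2
  have g2 := tr measurable_snd hγ2 hν2
  have g3 := tr measurable_fst hγ1 hφh
  have g4 := tr measurable_snd hγ2 hψν
  have g5 := integrable_inner_of_sq measurable_fst measurable_snd g1.1 g2.1
  have g6 := integral_norm_sub_sq measurable_fst measurable_snd g1.1 g2.1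
  -- `α` side
  have a1 := tr measurable_fst hα1 hμ2
  have a2 := tr measurable_snd hα2 hμh2
  have a3 := tr measurable_fst hα1 hφμ
  have a4 := tr measurable_snd hα2 hφh
  have a5 := tr measurable_fst hα1 hTx
  have a6 := tr measurable_fst hα1 hT2
  have a7 := integrable_inner_of_sq measurable_snd (hT.comp measurable_fst) a2.1 a6.1
  have a8 := integral_norm_sub_sq measurable_snd (hT.comp measurable_fst) a2.1 a6.1
  have a9 := integrable_norm_sub_sq measurable_fst measurable_snd a1.1 a2.1
  simp only [Function.comp_apply] at a7 a8
  have hPae : ∀ᵐ p ∂γ, p.2 ∈ P := by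
    have : ∀ᵐ y ∂ν, y ∈ P := by
      rw [← hpush]
      exact (ae_map_iff (p := fun y => y ∈ P) hT.aemeasurable hP).2 (ae_of_all _ hTP)
    rw [← hγ2] at this
    exact (ae_map_iff (p := fun y => y ∈ P) measurable_snd.aemeasurable hP).1 this
  have hle : ∀ᵐ p ∂γ, ‖T p.1 - p.2‖ ^ 2 ≤ 2 * lam * (φ p.1 + ψ p.2 - ⟪p.1, p.2⟫) := by
    filter_upwards [hPae] with p hp using hbound p.1 p.2 hp
  have hRint := ((g3.1.add g4.1).sub g5).const_mul (2 * lam)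
  have hLint : Integrable (fun p => ‖T p.1 - p.2‖ ^ 2) γ := by
    refine hRint.mono' ?_ ?_
    · exact (((hT.comp measurable_fst).sub measurable_snd).norm.pow_const 2).aestronglyMeasurable
    · filter_upwards [hle] with p hp
      rw [Real.norm_eq_abs, abs_of_nonneg (by positivity)]
      exact hp
  refine ⟨hLint, ?_⟩
  have s1 : ∫ p, ‖T p.1 - p.2‖ ^ 2 ∂γ
      ≤ 2 * lam * (∫ z, φ z ∂μh + ∫ y, ψ y ∂ν - ∫ p, ⟪p.1, p.2⟫ ∂γ) := by
    refine (integral_mono_ae hLint hRint hle).trans_eq ?_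
    rw [integral_const_mul]
    congr 1
    rw [integral_sub' (g3.1.add g4.1) g5, integral_add' g3.1 g4.1, g3.2, g4.2]
  have s2 : ∫ p, ⟪p.2, T p.1⟫ ∂α ≤ ∫ p, ⟪p.1, p.2⟫ ∂γ := by
    rw [g6, a8, g1.2, g2.2, a2.2, a6.2, hT2int] at hopt
    linarith
  have s3 : ∫ z, φ z ∂μh + (∫ x, ⟪x, T x⟫ ∂μ - ∫ x, φ x ∂μ) - ∫ p, ⟪p.2, T p.1⟫ ∂α
      ≤ lam / 2 * ∫ p, ‖p.1 - p.2‖ ^ 2 ∂α := by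
    have b1 : Integrable (fun p => ⟪p.1, T p.1⟫ - φ p.1) α := a5.1.sub a3.1
    have b2 : Integrable (fun p => φ p.2 + (⟪p.1, T p.1⟫ - φ p.1)) α := a4.1.add b1
    rw [← a4.2, ← a5.2, ← a3.2, ← integral_sub a5.1 a3.1, ← integral_add a4.1 b1,
      ← integral_sub b2 a7, ← integral_const_mul]
    refine integral_mono (b2.sub a7) (a9.const_mul _) fun p => ?_
    have := hsm p.1 p.2
    rw [inner_sub_right, real_inner_comm, real_inner_comm p.1, norm_sub_rev] at this
    simp only
    linarith
  rw [hψint] at s1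
  calc _ ≤ _ := s1
    _ ≤ 2 * lam * (lam / 2 * ∫ p, ‖p.1 - p.2‖ ^ 2 ∂α) := by
      apply mul_le_mul_of_nonneg_left _ (by positivity)
      linarith
    _ = _ := by ring

/-- The squared Wasserstein distance is bounded by the cost of any coupling of finite cost. -/
lemma W2_sq_le (μ ν : Measure (EuclideanSpace ℝ (Fin d)))
    (γ : Measure (EuclideanSpace ℝ (Fin d) × EuclideanSpace ℝ (Fin d)))
    (hγ : IsCoupling γ μ ν) (hi : Integrable (fun p => ‖p.1 - p.2‖ ^ 2) γ) :
    W2 μ ν ^ 2 ≤ ∫ p, ‖p.1 - p.2‖ ^ 2 ∂γ := by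
  unfold W2 W2Cost
  rw [Real.sq_sqrt ENNReal.toReal_nonneg]
  have h := ofReal_integral_eq_lintegral_ofReal hi (ae_of_all _ fun p => by positivity)
  have hn : 0 ≤ ∫ p, ‖p.1 - p.2‖ ^ 2 ∂γ := integral_nonneg fun p => by positivity
  refine ENNReal.toReal_le_of_le_ofReal hn ?_
  rw [h]
  exact iInf₂_le γ hγ

/-- A lower bound for the cost of all couplings bounds the squared Wasserstein distance below. -/
lemma le_W2_sq (μ ν : Measure (EuclideanSpace ℝ (Fin d)))
    [IsProbabilityMeasure μ] [IsProbabilityMeasure ν]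
    (hμ2 : Integrable (fun x => ‖x‖ ^ 2) μ) (hν2 : Integrable (fun x => ‖x‖ ^ 2) ν) (c : ℝ)
    (hc : ∀ γ : Measure (EuclideanSpace ℝ (Fin d) × EuclideanSpace ℝ (Fin d)),
      IsCoupling γ μ ν → c ≤ ∫ p, ‖p.1 - p.2‖ ^ 2 ∂γ) :
    c ≤ W2 μ ν ^ 2 := by
  have key : ∀ γ : Measure (EuclideanSpace ℝ (Fin d) × EuclideanSpace ℝ (Fin d)),
      IsCoupling γ μ ν → Integrable (fun p => ‖p.1 - p.2‖ ^ 2) γ := by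
    rintro γ ⟨h1, h2⟩
    rw [← h1] at hμ2
    rw [← h2] at hν2
    exact integrable_norm_sub_sq measurable_fst measurable_snd
      (hμ2.comp_measurable measurable_fst) (hν2.comp_measurable measurable_snd)
  unfold W2 W2Cost
  rw [Real.sq_sqrt ENNReal.toReal_nonneg]
  have hprod : IsCoupling (μ.prod ν) μ ν := by
    constructor
    · simp
    · simp
  have hle : ENNReal.ofReal c ≤ ⨅ γ ∈ {γ : Measure (EuclideanSpace ℝ (Fin d) ×
      EuclideanSpace ℝ (Fin d)) | IsCoupling γ μ ν},
      ∫⁻ p, ENNReal.ofReal (‖p.1 - p.2‖ ^ 2) ∂γ := by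
    refine le_iInf₂ fun γ hγ => ?_
    rw [← ofReal_integral_eq_lintegral_ofReal (key γ hγ) (ae_of_all _ fun p => by positivity)]
    exact ENNReal.ofReal_le_ofReal (hc γ hγ)
  have hfin : (⨅ γ ∈ {γ : Measure (EuclideanSpace ℝ (Fin d) ×
      EuclideanSpace ℝ (Fin d)) | IsCoupling γ μ ν},
      ∫⁻ p, ENNReal.ofReal (‖p.1 - p.2‖ ^ 2) ∂γ) ≠ ⊤ := by
    refine ne_top_of_le_ne_top ?_ (iInf₂_le (μ.prod ν) hprod)
    rw [← ofReal_integral_eq_lintegral_ofReal (key _ hprod) (ae_of_all _ fun p => by positivity)]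
    exact ENNReal.ofReal_ne_top
  exact (ENNReal.ofReal_le_iff_le_toReal hfin).1 hle

end core

/-- Convergence rate for semi-discrete schemes: if `(μ, ν, φ)` is `λ`-regular with optimal map
`T = ∇φ`, `ν` has density `g`, `μ_h = Σ f_i δ_{x_i}`, `φ_h` solves the semi-discrete problem
`ν(F_i) = f_i` with Laguerre cells `F_i`, and the induced plan `γ_h` is an optimal coupling of
`(μ_h, ν)`, then `Σ_i ∫_{F_i} |T(x_i) − y|² g(y) dy ≤ E_h²`. -/
theorem semi_discrete_error_estimate {d N : ℕ} (lam : ℝ) (hlam : 0 < lam)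
    (μ ν : Measure (EuclideanSpace ℝ (Fin d)))
    [IsProbabilityMeasure μ] [IsProbabilityMeasure ν]
    (hμ2 : Integrable (fun x => ‖x‖ ^ 2) μ) (hν2 : Integrable (fun x => ‖x‖ ^ 2) ν)
    (g : EuclideanSpace ℝ (Fin d) → ℝ) (hgpos : ∀ y, 0 ≤ g y) (hgmeas : Measurable g)
    (hν : ν = volume.withDensity (fun y => ENNReal.ofReal (g y)))
    (φ : EuclideanSpace ℝ (Fin d) → ℝ)
    (hreg : LambdaRegular lam μ ν φ)
    (x : Fin N → EuclideanSpace ℝ (Fin d)) (hx : Function.Injective x)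
    (f : Fin N → ℝ) (hf : ∀ i, 0 < f i) (hfsum : ∑ i, f i = 1)
    (μh : Measure (EuclideanSpace ℝ (Fin d)))
    (hμh : μh = ∑ i, ENNReal.ofReal (f i) • Measure.dirac (x i))
    (φh : Fin N → ℝ)
    (F : Fin N → Set (EuclideanSpace ℝ (Fin d)))
    (hF : ∀ i, F i = {y | ∀ j, φh i + ⟪y, x j - x i⟫ ≤ φh j} ∩ {y | 0 < g y})
    (hsolve : ∀ i, ν (F i) = ENNReal.ofReal (f i))
    (γh : Measure (EuclideanSpace ℝ (Fin d) × EuclideanSpace ℝ (Fin d)))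
    (hγh : γh = ∑ i, (ν.restrict (F i)).map (fun y => (x i, y)))
    (hcoup : IsCoupling γh μh ν)
    (hopt : ∫ p, ‖p.1 - p.2‖ ^ 2 ∂γh = (W2 μh ν) ^ 2)
    (Eh : ℝ)
    (hEh : Eh = 2 * Real.sqrt lam * Real.sqrt (W2 μ μh) * Real.sqrt (W2 μ ν + W2 μ μh)
        + lam * W2 μ μh) :
    ∑ i, ∫ y in F i, ‖gradient φ (x i) - y‖ ^ 2 * g y ≤ Eh ^ 2 := by
  obtain ⟨hconv, hdiff, hsmooth, hpush, -⟩ := hreg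
  have hμhprob : IsProbabilityMeasure μh := by
    constructor
    rw [hμh]
    simp only [Measure.coe_finsetSum, Finset.sum_apply, Measure.smul_apply, measure_univ,
      smul_eq_mul, mul_one]
    rw [← ENNReal.ofReal_sum_of_nonneg fun i _ => (hf i).le, hfsum, ENNReal.ofReal_one]
  have hμh2 : Integrable (fun x => ‖x‖ ^ 2) μh := by
    rw [hμh, integrable_finsetSum_measure]
    intro i _
    exact (integrable_dirac (by simp)).smul_measure ENNReal.ofReal_ne_top
  have hT : Measurable (fun z => gradient φ z) := by
    have : Measurable (fderiv ℝ φ) := measurable_fderiv ℝ φ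
    exact (InnerProductSpace.toDual ℝ (EuclideanSpace ℝ (Fin d))).symm.continuous.measurable.comp
      this
  have hgrad : ∀ z v, fderiv ℝ φ z v = ⟪gradient φ z, v⟫ := by
    intro z v
    rw [← toDual_gradient, InnerProductSpace.toDual_apply_apply]
  have hsup : ∀ a z, φ a + ⟪gradient φ a, z - a⟫ ≤ φ z := by
    intro a z
    have := convex_grad_ineq (z := z) hconv (hdiff a).hasFDerivAt
    rwa [hgrad] at this
  have hsm : ∀ a z, φ z ≤ φ a + ⟪gradient φ a, z - a⟫ + lam / 2 * ‖z - a‖ ^ 2 := by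
    intro a z
    have hd : HasFDerivAt (fun x => lam / 2 * ‖x‖ ^ 2 - φ x)
        ((lam / 2) • (2 • innerSL ℝ a) - fderiv ℝ φ a) a :=
      ((hasStrictFDerivAt_norm_sq a).hasFDerivAt.const_mul (lam / 2)).sub (hdiff a).hasFDerivAt
    have := convex_grad_ineq (z := z) hsmooth hd
    simp only [ContinuousLinearMap.sub_apply, ContinuousLinearMap.smul_apply, hgrad,
      innerSL_apply_apply, smul_eq_mul, nsmul_eq_mul] at this
    have e1 : ‖z - a‖ ^ 2 = ‖z‖ ^ 2 - 2 * ⟪a, z⟫ + ‖a‖ ^ 2 := by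
      rw [norm_sub_sq_real, real_inner_comm]
    have e2 : ⟪a, z - a⟫ = ⟪a, z⟫ - ‖a‖ ^ 2 := by
      rw [inner_sub_right, real_inner_self_eq_norm_sq]
    rw [e2] at this
    rw [e1]
    push_cast at this
    linarith
  have hT2 : Integrable (fun x => ‖gradient φ x‖ ^ 2) μ := by
    rw [← hpush] at hν2
    exact hν2.comp_measurable hT
  -- the estimate for each coupling
  have main : ∀ α : Measure (EuclideanSpace ℝ (Fin d) × EuclideanSpace ℝ (Fin d)),
      IsCoupling α μ μh →
      Integrable (fun p => ‖gradient φ p.1 - p.2‖ ^ 2) γh ∧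
      ∫ p, ‖gradient φ p.1 - p.2‖ ^ 2 ∂γh ≤ lam ^ 2 * ∫ p, ‖p.1 - p.2‖ ^ 2 ∂α := by
    intro α hα
    refine core_estimate hlam hdiff.continuous hT hsup hsm μ ν μh hμ2 hν2 hμh2 hpush γh α hcoup hα ?_
    rw [hopt]
    have hS : Measurable fun p : EuclideanSpace ℝ (Fin d) × EuclideanSpace ℝ (Fin d) =>
        (p.2, gradient φ p.1) := measurable_snd.prodMk (hT.comp measurable_fst)
    have hβ : IsCoupling (α.map fun p => (p.2, gradient φ p.1)) μh ν := by
      constructor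
      · rw [Measure.map_map measurable_fst hS]
        exact hα.2
      · rw [Measure.map_map measurable_snd hS, ← hpush, ← hα.1, Measure.map_map hT measurable_fst]
        rfl
    have hsm2 : AEStronglyMeasurable (fun p : EuclideanSpace ℝ (Fin d) × EuclideanSpace ℝ (Fin d) =>
        ‖p.1 - p.2‖ ^ 2) (α.map fun p => (p.2, gradient φ p.1)) :=
      (by fun_prop : Continuous fun p : EuclideanSpace ℝ (Fin d) × EuclideanSpace ℝ (Fin d) =>
        ‖p.1 - p.2‖ ^ 2).aestronglyMeasurable
    have hi : Integrable (fun p => ‖p.2 - gradient φ p.1‖ ^ 2) α := by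
      have hA := hμh2
      have hB := hT2
      rw [← hα.2] at hA
      rw [← hα.1] at hB
      exact integrable_norm_sub_sq measurable_snd (hT.comp measurable_fst)
        (hA.comp_measurable measurable_snd) (hB.comp_measurable measurable_fst)
    have := W2_sq_le μh ν _ hβ ((integrable_map_measure hsm2 hS.aemeasurable).2 hi)
    rwa [integral_map hS.aemeasurable hsm2] at this
  have hprod : IsCoupling (μ.prod μh) μ μh := by
    constructor
    · simp
    · simp
  have hint := (main _ hprod).1
  -- the left-hand side as an integral against the plan
  have hlhs : ∑ i, ∫ y in F i, ‖gradient φ (x i) - y‖ ^ 2 * g y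
      = ∫ p, ‖gradient φ p.1 - p.2‖ ^ 2 ∂γh := by
    rw [hγh] at hint ⊢
    rw [integral_finsetSum_measure (integrable_finsetSum_measure.1 hint)]
    refine Finset.sum_congr rfl fun i _ => ?_
    have hFm : MeasurableSet (F i) := by
      rw [hF]
      refine MeasurableSet.inter ?_ (measurableSet_lt measurable_const hgmeas)
      have : {y : EuclideanSpace ℝ (Fin d) | ∀ j, φh i + ⟪y, x j - x i⟫ ≤ φh j}
          = ⋂ j, {y | φh i + ⟪y, x j - x i⟫ ≤ φh j} := by ext y; simp
      rw [this]
      exact (isClosed_iInter fun j => isClosed_le (by fun_prop) continuous_const).measurableSet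
    have hmeas : Measurable fun y : EuclideanSpace ℝ (Fin d) => (x i, y) :=
      measurable_const.prodMk measurable_id
    have hcm : Measurable fun p : EuclideanSpace ℝ (Fin d) × EuclideanSpace ℝ (Fin d) =>
        ‖gradient φ p.1 - p.2‖ ^ 2 :=
      ((hT.comp measurable_fst).sub measurable_snd).norm.pow_const 2
    rw [integral_map hmeas.aemeasurable hcm.aestronglyMeasurable]
    rw [hν, setIntegral_withDensity_eq_setIntegral_toReal_smul hgmeas.ennreal_ofReal
      (ae_of_all _ fun y => ENNReal.ofReal_lt_top) _ hFm]
    refine integral_congr_ae (ae_of_all _ fun y => ?_)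
    simp only [ENNReal.toReal_ofReal (hgpos y), smul_eq_mul]
    ring
  rw [hlhs]
  have hfinal : (∫ p, ‖gradient φ p.1 - p.2‖ ^ 2 ∂γh) / lam ^ 2 ≤ W2 μ μh ^ 2 := by
    refine le_W2_sq μ μh hμ2 hμh2 _ fun α hα => ?_
    rw [div_le_iff₀ (by positivity), mul_comm]
    exact (main α hα).2
  rw [div_le_iff₀ (by positivity)] at hfinal
  have hW : 0 ≤ W2 μ μh := Real.sqrt_nonneg _
  have hE : lam * W2 μ μh ≤ Eh := by
    rw [hEh]
    have : 0 ≤ 2 * Real.sqrt lam * Real.sqrt (W2 μ μh) * Real.sqrt (W2 μ ν + W2 μ μh) := by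
      positivity
    linarith
  calc _ ≤ _ := hfinal
    _ = (lam * W2 μ μh) ^ 2 := by ring
    _ ≤ Eh ^ 2 := pow_le_pow_left₀ (by positivity) hE 2
end
end

section
/- For every dimension d ≥ 1 and constants 0 < c₁ ≤ c₂ there exists a constant C > 0, depending only on d, c₁ and c₂, with the following property: for every bounded convex set K ⊂ ℝ^d with nonempty interior and every measurable function g with c₁ ≤ g(y) ≤ c₂ for all y ∈ K, setting f = ∫_K g(y) dy and m = f^{-1} ∫_K y g(y) dy, one has ∫_K |m − y|² g(y) dy ≥ C f diam(K)². -/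
open MeasureTheory

noncomputable section

/-- For every dimension `d ≥ 1` and constants `0 < c₁ ≤ c₂` there is a constant `C > 0` such
that for every bounded convex set `K ⊂ ℝ^d` with nonempty interior and every measurable weight
`g` with `c₁ ≤ g ≤ c₂` on `K`, letting `f = ∫_K g` and `m` be the `g`-barycenter of `K`, one has
`∫_K |m − y|² g(y) dy ≥ C f diam(K)²`. -/
theorem second_moment_lower_bound_convex (d : ℕ) (hd : 1 ≤ d)
    (c₁ c₂ : ℝ) (hc₁ : 0 < c₁) (hc₁₂ : c₁ ≤ c₂) :
    ∃ C > 0, ∀ K : Set (EuclideanSpace ℝ (Fin d)),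
      Convex ℝ K → Bornology.IsBounded K → (interior K).Nonempty →
      ∀ g : EuclideanSpace ℝ (Fin d) → ℝ, Measurable g →
        (∀ y ∈ K, c₁ ≤ g y ∧ g y ≤ c₂) →
        C * (∫ y in K, g y) * Metric.diam K ^ 2 ≤
          ∫ y in K, ‖((∫ z in K, g z)⁻¹ • ∫ z in K, g z • z) - y‖ ^ 2 * g y := by
  have hc₂ : 0 < c₂ := hc₁.trans_le hc₁₂
  refine ⟨(1/8)^2 * (1/8)^d * (c₁ / c₂), by positivity, ?_⟩
  intro K hK hb hne g hg hgK
  generalize ((∫ z in K, g z)⁻¹ • ∫ z in K, g z • z) = m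
  set D := Metric.diam K with hD
  have hD0 : 0 ≤ D := Metric.diam_nonneg
  have hKm : NullMeasurableSet K := hK.nullMeasurableSet volume
  have hKfin : volume K ≠ ⊤ := hb.measure_lt_top.ne
  obtain ⟨x0, hx0⟩ := hne
  have hx0K := interior_subset hx0
  -- a point far from m
  obtain ⟨p, hp, hpm⟩ : ∃ p ∈ K, D / 4 ≤ dist m p := by
    by_contra! h
    rcases hD0.eq_or_lt with h0 | h0
    · have := h x0 hx0K
      rw [← h0] at this
      have := dist_nonneg (x := m) (y := x0)
      linarith
    · have : D ≤ D / 2 := by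
        apply Metric.diam_le_of_forall_dist_le (by positivity)
        intro a ha b hb'
        have h1 := h a ha
        have h2 := h b hb'
        have := dist_triangle_left a b m
        linarith
      linarith
  set L := AffineMap.homothety p (1/8 : ℝ) '' K with hL
  have hLK : L ⊆ K := by
    rintro _ ⟨y, hy, rfl⟩
    have := hK hp hy (a := 7/8) (b := 1/8) (by norm_num) (by norm_num) (by norm_num)
    convert this using 1
    simp only [AffineMap.homothety_apply, vsub_eq_sub, vadd_eq_add]
    module
  have hLfar : ∀ y ∈ L, D / 8 ≤ ‖m - y‖ := by
    rintro _ ⟨y, hy, rfl⟩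
    have h1 : dist (AffineMap.homothety p (1/8 : ℝ) y) p = 1/8 * dist p y := by
      rw [dist_homothety_center]
      norm_num
    have h2 := Metric.dist_le_diam_of_mem hb hp hy
    have h3 := dist_triangle m (AffineMap.homothety p (1/8 : ℝ) y) p
    rw [← dist_eq_norm]
    linarith
  have hLm : NullMeasurableSet L := by
    apply Convex.nullMeasurableSet
    exact hK.affine_image _
  have hLvol : volume.real L = (1/8)^d * volume.real K := by
    rw [Measure.real, hL, Measure.addHaar_image_homothety, ENNReal.toReal_mul,
      ENNReal.toReal_ofReal (by positivity)]
    simp [Measure.real]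
  have hLfin : volume L ≠ ⊤ := ((measure_mono hLK).trans_lt hb.measure_lt_top).ne
  have hf : ∫ y in K, g y ≤ c₂ * volume.real K := by
    have hgi : IntegrableOn g K := by
      apply Measure.integrableOn_of_bounded hKfin hg.aestronglyMeasurable (M := c₂)
      rw [ae_restrict_iff'₀ hKm]
      refine .of_forall fun y hy => ?_
      rw [Real.norm_of_nonneg (hc₁.le.trans (hgK y hy).1)]
      exact (hgK y hy).2
    calc _ ≤ ∫ y in K, c₂ := setIntegral_mono_on₀ hgi (integrableOn_const hKfin) hKm
            (fun y hy => (hgK y hy).2)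
      _ = _ := by rw [setIntegral_const, smul_eq_mul, mul_comm]
  obtain ⟨R, hR⟩ : ∃ R, ∀ y ∈ K, ‖m - y‖ ≤ R := by
    refine ⟨‖m - p‖ + D, fun y hy => ?_⟩
    have := Metric.dist_le_diam_of_mem hb hp hy
    rw [← dist_eq_norm, ← dist_eq_norm]
    linarith [dist_triangle m p y]
  have hFi : IntegrableOn (fun y => ‖m - y‖ ^ 2 * g y) K := by
    apply Measure.integrableOn_of_bounded hKfin (by fun_prop) (M := R ^ 2 * c₂)
    rw [ae_restrict_iff'₀ hKm]
    refine .of_forall fun y hy => ?_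
    have h0 := hc₁.le.trans (hgK y hy).1
    rw [Real.norm_of_nonneg (by positivity)]
    have := hR y hy
    have := (hgK y hy).2
    gcongr
  have hpos : 0 ≤ᵐ[volume.restrict K] (fun y => ‖m - y‖ ^ 2 * g y) := by
    rw [Filter.EventuallyLE, ae_restrict_iff'₀ hKm]
    refine .of_forall fun y hy => ?_
    have h0 := hc₁.le.trans (hgK y hy).1
    simp only [Pi.zero_apply]
    positivity
  calc (1/8)^2 * (1/8)^d * (c₁ / c₂) * (∫ y in K, g y) * D ^ 2
      ≤ (1/8)^2 * (1/8)^d * (c₁ / c₂) * (c₂ * volume.real K) * D ^ 2 := by gcongr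
    _ = (D / 8) ^ 2 * c₁ * volume.real L := by rw [hLvol]; field_simp
    _ = ∫ y in L, (D / 8) ^ 2 * c₁ := by rw [setIntegral_const, smul_eq_mul, mul_comm]
    _ ≤ ∫ y in L, ‖m - y‖ ^ 2 * g y := by
      refine setIntegral_mono_on₀ (integrableOn_const hLfin) (hFi.mono_set hLK) hLm fun y hy => ?_
      have := hLfar y hy
      have := (hgK y (hLK hy)).1
      gcongr
    _ ≤ _ := setIntegral_mono_set hFi hpos hLK.eventuallyLE
end
end

section
/- There exists a constant c_d > 0 depending only on the dimension d such that for every z ∈ ℝ^d and every ellipsoid E₀ = z + A(B̄), where A : ℝ^d → ℝ^d is an invertible linear map and B̄ is the closed unit ball of ℝ^d, one has ∫_{E₀} |y − z|² dy ≥ c_d |E₀| diam(E₀)², where |E₀| denotes the Lebesgue measure of E₀. -/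
open MeasureTheory

noncomputable section

open scoped Pointwise

/-- One translate: `∫_{T} |p + w|² ≤ ∫_E |y - z|²` when `z + p + T ⊆ E`. -/
lemma ellipsoid_aux_translate {d : ℕ} (E T : Set (EuclideanSpace ℝ (Fin d)))
    (hE : IsCompact E) (z p : EuclideanSpace ℝ (Fin d))
    (h : ∀ w ∈ T, (z + p) + w ∈ E) :
    ∫ w in T, ‖p + w‖ ^ 2 ≤ ∫ y in E, ‖y - z‖ ^ 2 := by
  have h1 : ∫ y in (fun w => (z + p) + w) '' T, ‖y - z‖ ^ 2 = ∫ w in T, ‖p + w‖ ^ 2 := by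
    rw [(measurePreserving_add_left volume (z + p)).setIntegral_image_emb
      (measurableEmbedding_addLeft (z + p))]
    congr 1
    ext w
    congr 2
    abel
  rw [← h1]
  apply setIntegral_mono_set
  · exact (Continuous.continuousOn (by fun_prop)).integrableOn_compact hE
  · exact Filter.Eventually.of_forall fun y => by positivity
  · apply LE.le.eventuallyLE
    rintro _ ⟨w, hw, rfl⟩
    exact h w hw

/-- There is a dimensional constant `c_d > 0` such that every ellipsoid `E₀ = z + A(B̄)`
(with `A` an invertible linear map and `B̄` the closed unit ball) satisfies
`∫_{E₀} |y − z|² dy ≥ c_d |E₀| diam(E₀)²`. -/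
theorem ellipsoid_second_moment_lower_bound (d : ℕ) :
    ∃ c > 0, ∀ (z : EuclideanSpace ℝ (Fin d)) (A : EuclideanSpace ℝ (Fin d) ≃ₗ[ℝ]
        EuclideanSpace ℝ (Fin d)),
      c * (volume ((fun v => z + A v) '' Metric.closedBall (0 : EuclideanSpace ℝ (Fin d)) 1)).toReal
          * Metric.diam ((fun v => z + A v) ''
              Metric.closedBall (0 : EuclideanSpace ℝ (Fin d)) 1) ^ 2 ≤
        ∫ y in (fun v => z + A v) '' Metric.closedBall (0 : EuclideanSpace ℝ (Fin d)) 1,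
          ‖y - z‖ ^ 2 := by
  refine ⟨1 / (16 * 2 ^ d), by positivity, fun z A => ?_⟩
  have hA : Continuous A := A.toLinearMap.continuous_of_finiteDimensional
  set B := Metric.closedBall (0 : EuclideanSpace ℝ (Fin d)) 1 with hB
  set E := (fun v => z + A v) '' B with hEdef
  have hBc : IsCompact B := isCompact_closedBall _ _
  have hE : IsCompact E := hBc.image (by fun_prop)
  set S := A '' B with hS
  have hSc : IsCompact S := hBc.image hA
  set T := (1 / 2 : ℝ) • S with hT
  have hTc : IsCompact T := hSc.smul _
  have hES : E = (fun w => z + w) '' S := by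
    rw [hEdef, hS, Set.image_image]
  have hvE : volume E = volume S := by
    rw [hES]; simp
  have hvT : (volume T).toReal = (1 / 2 ^ d) * (volume E).toReal := by
    rw [hT, Measure.addHaar_smul, hvE, ENNReal.toReal_mul, finrank_euclideanSpace_fin,
      ENNReal.toReal_ofReal (abs_nonneg _), abs_of_pos (by positivity), div_pow, one_pow]
  set I := ∫ y in E, ‖y - z‖ ^ 2 with hI
  have hI0 : 0 ≤ I := integral_nonneg fun y => by positivity
  have key : ∀ v ∈ B, (volume E).toReal * ‖A v‖ ^ 2 ≤ 4 * 2 ^ d * I := by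
    intro v hv
    have hsub : ∀ u ∈ B, ∀ w ∈ T, (z + (1 / 2 : ℝ) • A u) + w ∈ E := by
      rintro u hu _ ⟨_, ⟨x, hx, rfl⟩, rfl⟩
      refine ⟨(1 / 2 : ℝ) • u + (1 / 2 : ℝ) • x, ?_, ?_⟩
      · exact (convex_closedBall _ _) hu hx (by norm_num) (by norm_num) (by norm_num)
      · simp [add_assoc]
    have hv' : -v ∈ B := by simpa [hB] using hv
    have h1 := ellipsoid_aux_translate E T hE z _ (hsub v hv)
    have h2 := ellipsoid_aux_translate E T hE z _ (hsub (-v) hv')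
    have hintegr : ∀ q : EuclideanSpace ℝ (Fin d), IntegrableOn (fun w => ‖q + w‖ ^ 2) T :=
      fun q => (Continuous.continuousOn (by fun_prop)).integrableOn_compact hTc
    have h3 : ∫ _w in T, ‖A v‖ ^ 2 / 2 ≤
        ∫ w in T, (‖(1 / 2 : ℝ) • A v + w‖ ^ 2 + ‖(1 / 2 : ℝ) • A (-v) + w‖ ^ 2) := by
      apply integral_mono
      · exact integrableOn_const hTc.measure_lt_top.ne
      · exact (hintegr _).add (hintegr _)
      · intro w
        have hp := parallelogram_law_with_norm ℝ w ((1 / 2 : ℝ) • A v)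
        have e1 : (1 / 2 : ℝ) • A v + w = w + (1 / 2 : ℝ) • A v := add_comm _ _
        have e2 : (1 / 2 : ℝ) • A (-v) + w = w - (1 / 2 : ℝ) • A v := by
          rw [map_neg, smul_neg]; abel
        have e3 : ‖(1 / 2 : ℝ) • A v‖ = 1 / 2 * ‖A v‖ := by
          rw [norm_smul]; norm_num
        simp only [e1, e2]
        rw [e3] at hp
        nlinarith [mul_self_nonneg ‖w‖]
    rw [integral_add (hintegr _) (hintegr _), setIntegral_const, smul_eq_mul, Measure.real, hvT] at h3
    have h4 : 1 / 2 ^ d * (volume E).toReal * (‖A v‖ ^ 2 / 2) ≤ 2 * I := by linarith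
    have h2d : (0 : ℝ) < 2 ^ d := by positivity
    have h5 := mul_le_mul_of_nonneg_left h4 h2d.le
    have h6 : (2 : ℝ) ^ d * (1 / 2 ^ d * (volume E).toReal * (‖A v‖ ^ 2 / 2))
      = (volume E).toReal * ‖A v‖ ^ 2 / 2 := by field_simp
    rw [h6] at h5
    linarith
  have hV0 : 0 ≤ (volume E).toReal := ENNReal.toReal_nonneg
  rcases hV0.eq_or_lt with hV | hV
  · rw [← hV]; simpa using hI0
  set K := Real.sqrt (4 * 2 ^ d * I / (volume E).toReal) with hK
  have hdiam : Metric.diam E ≤ 2 * K := by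
    apply Metric.diam_le_of_forall_dist_le (by positivity)
    rintro _ ⟨x, hx, rfl⟩ _ ⟨y, hy, rfl⟩
    have hK' : ∀ v ∈ B, ‖A v‖ ≤ K := fun v hv => by
      apply Real.le_sqrt_of_sq_le
      rw [le_div_iff₀ hV]
      linarith [key v hv]
    simp only [dist_add_left]
    rw [dist_eq_norm]
    linarith [norm_sub_le (A x) (A y), hK' x hx, hK' y hy]
  have hK2 : K ^ 2 = 4 * 2 ^ d * I / (volume E).toReal := Real.sq_sqrt (by positivity)
  have hd2 : Metric.diam E ^ 2 ≤ (2 * K) ^ 2 := pow_le_pow_left₀ Metric.diam_nonneg hdiam 2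
  calc 1 / (16 * 2 ^ d) * (volume E).toReal * Metric.diam E ^ 2
      ≤ 1 / (16 * 2 ^ d) * (volume E).toReal * (2 * K) ^ 2 := by gcongr
    _ = I := by
      rw [mul_pow, hK2]; field_simp; norm_num
end
end
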